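/- For every natural number n ≥ 3, one has d(2n−5, 5) = c_n − 4·c_{n−1} + 3·c_{n−2}. -/

import Mathlib

open Finset

/-- Step value: `true` is an up-step (+1), `false` a down-step (−1). -/
def dyckStep (b : Bool) : ℤ := if b then 1 else -1

/-- Sum of the first `k` steps of the path `w`. -/
def dyckPSum {m : ℕ} (w : Fin m → Bool) (k : ℕ) : ℤ :=
  ∑ t ∈ Finset.univ.filter (fun t : Fin m => (t : ℕ) < k), dyckStep (w t)

/-- `dyckD i j`: the number of lattice paths of length `i` from `(0,0)` to `(i,j)`
using steps `(1,1)` and `(1,-1)` that never go below the x-axis; equivalently the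
number of `±1`-lists of length `i` all of whose partial sums are nonnegative and
whose total sum is `j`. -/
def dyckD (i j : ℕ) : ℕ :=
  (Finset.univ.filter (fun w : Fin i → Bool =>
    (∀ k ≤ i, 0 ≤ dyckPSum w k) ∧ dyckPSum w i = (j : ℤ))).card

/-- The number of `±1`-lists of length `i` with nonnegative partial sums and total sum `j`,
where the integer `j` may be negative. -/
def nonnegWalkCount (i : ℕ) (j : ℤ) : ℕ :=
  (Finset.univ.filter (fun w : Fin i → Bool =>
    (∀ k ≤ i, 0 ≤ dyckPSum w k) ∧ dyckPSum w i = j)).card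

theorem dyckPSum_snoc_of_le {m : ℕ} (w : Fin m → Bool) (b : Bool) {k : ℕ} (hk : k ≤ m) :
    dyckPSum (Fin.snoc w b : Fin (m + 1) → Bool) k = dyckPSum w k := by
  simp only [dyckPSum, Finset.sum_filter, Fin.sum_univ_castSucc, Fin.snoc_castSucc,
    Fin.val_castSucc, Fin.val_last, if_neg hk.not_gt, add_zero]

theorem dyckPSum_snoc_last {m : ℕ} (w : Fin m → Bool) (b : Bool) :
    dyckPSum (Fin.snoc w b : Fin (m + 1) → Bool) (m + 1) = dyckPSum w m + dyckStep b := by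
  simp only [dyckPSum, Finset.sum_filter, Fin.sum_univ_castSucc, Fin.snoc_castSucc,
    Fin.val_castSucc, Fin.val_last, Fin.snoc_last, if_pos (Nat.lt_succ_self m)]
  congr 1
  refine Finset.sum_congr rfl fun t _ => ?_
  rw [if_pos t.isLt, if_pos (t.isLt.trans (Nat.lt_succ_self m))]

theorem nonnegWalkCount_of_neg (i : ℕ) {j : ℤ} (hj : j < 0) : nonnegWalkCount i j = 0 := by
  rw [nonnegWalkCount, Finset.card_eq_zero, Finset.filter_eq_empty_iff]
  rintro w - ⟨h, rfl⟩
  exact absurd (h i le_rfl) hj.not_ge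

theorem nonnegWalkCount_succ (i : ℕ) {j : ℤ} (hj : 0 ≤ j) :
    nonnegWalkCount (i + 1) j = nonnegWalkCount i (j - 1) + nonnegWalkCount i (j + 1) := by
  have key (w : Fin i → Bool) (b : Bool) :
      ((∀ k ≤ i + 1, 0 ≤ dyckPSum (Fin.snoc w b : Fin (i + 1) → Bool) k) ∧
        dyckPSum (Fin.snoc w b : Fin (i + 1) → Bool) (i + 1) = j) ↔
      ((∀ k ≤ i, 0 ≤ dyckPSum w k) ∧ dyckPSum w i = j - dyckStep b) := by
    rw [dyckPSum_snoc_last]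
    constructor
    · rintro ⟨h, hs⟩
      refine ⟨fun k hk => ?_, by linarith⟩
      rw [← dyckPSum_snoc_of_le w b hk]
      exact h k (by omega)
    · rintro ⟨h, hs⟩
      refine ⟨fun k hk => ?_, by linarith⟩
      rcases Nat.le_succ_iff.1 hk with hk | rfl
      · rw [dyckPSum_snoc_of_le w b hk]
        exact h k hk
      · rw [Nat.succ_eq_add_one, dyckPSum_snoc_last]
        linarith
  simp only [nonnegWalkCount, Finset.card_filter]
  rw [← (Fin.snocEquiv fun _ => Bool).sum_comp, Fintype.sum_prod_type, Fintype.sum_bool]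
  simp only [Fin.snocEquiv, Equiv.coe_fn_mk, key]
  simp [dyckStep]

theorem nonnegWalkCount_of_lt (i : ℕ) {j : ℤ} (hj : (i : ℤ) < j) : nonnegWalkCount i j = 0 := by
  induction i generalizing j with
  | zero =>
    rw [nonnegWalkCount, Finset.card_eq_zero, Finset.filter_eq_empty_iff]
    rintro w - ⟨-, rfl⟩
    simp [dyckPSum] at hj
  | succ i ih =>
    push_cast at hj
    rw [nonnegWalkCount_succ i (by omega), ih (by omega), ih (by omega)]

theorem dyckD_zero_zero : dyckD 0 0 = 1 := by
  simp [dyckD, dyckPSum]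

theorem dyckD_of_lt {i j : ℕ} (h : i < j) : dyckD i j = 0 :=
  nonnegWalkCount_of_lt i (by exact_mod_cast h)

theorem dyckD_succ_zero (i : ℕ) : dyckD (i + 1) 0 = dyckD i 1 := by
  have h := nonnegWalkCount_succ i le_rfl
  rw [nonnegWalkCount_of_neg i (by norm_num), zero_add] at h
  exact h

theorem dyckD_succ_succ (i j : ℕ) : dyckD (i + 1) (j + 1) = dyckD i j + dyckD i (j + 2) := by
  have h := nonnegWalkCount_succ i (j := ((j + 1 : ℕ) : ℤ)) (by positivity)
  rw [show ((j + 1 : ℕ) : ℤ) - 1 = (j : ℕ) by push_cast; ring,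
    show ((j + 1 : ℕ) : ℤ) + 1 = (j + 2 : ℕ) by push_cast; ring] at h
  exact h

theorem dyckD_self (j : ℕ) : dyckD j j = 1 := by
  induction j with
  | zero => exact dyckD_zero_zero
  | succ j ih => rw [dyckD_succ_succ, ih, dyckD_of_lt (by omega)]

/-- The ballot formula for paths with `k + 1` down-steps. -/
theorem dyckD_add_choose (k j : ℕ) :
    dyckD (2 * k + j + 2) j + (2 * k + j + 2).choose k = (2 * k + j + 2).choose (k + 1) := by
  induction k generalizing j with
  | zero =>
    induction j with
    | zero =>
      rw [dyckD_succ_zero]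
      simp [dyckD_self]
    | succ j ih =>
      rw [show 2 * 0 + (j + 1) + 2 = (j + 2) + 1 by ring, dyckD_succ_succ, dyckD_self]
      simp only [mul_zero, zero_add, Nat.choose_zero_right, Nat.choose_one_right] at ih ⊢
      omega
  | succ k ihk =>
    induction j with
    | zero =>
      have h := ihk 1
      rw [show 2 * k + 1 + 2 = 2 * k + 3 by ring] at h
      have hs : (2 * k + 3).choose (k + 2) = (2 * k + 3).choose (k + 1) :=
        Nat.choose_symm_of_eq_add (by ring)
      rw [show 2 * (k + 1) + 0 + 2 = (2 * k + 3) + 1 by ring, dyckD_succ_zero,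
        Nat.choose_succ_succ' _ k, Nat.choose_succ_succ' _ (k + 1), hs]
      omega
    | succ j ih =>
      have h := ihk (j + 2)
      rw [show 2 * k + (j + 2) + 2 = 2 * k + j + 4 by ring] at h
      rw [show 2 * (k + 1) + j + 2 = 2 * k + j + 4 by ring] at ih
      rw [show 2 * (k + 1) + (j + 1) + 2 = (2 * k + j + 4) + 1 by ring, dyckD_succ_succ,
        Nat.choose_succ_succ' _ k, Nat.choose_succ_succ' _ (k + 1)]
      omega

theorem dyckD_two_mul_zero (n : ℕ) : dyckD (2 * n) 0 = catalan n := by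
  cases n with
  | zero => simp [dyckD_zero_zero]
  | succ k =>
    have h := dyckD_add_choose k 0
    have hc := succ_mul_catalan_eq_centralBinom (k + 1)
    have hr := Nat.choose_succ_right_eq (2 * k + 2) k
    rw [Nat.centralBinom, show 2 * (k + 1) = 2 * k + 2 by ring] at hc
    rw [show 2 * k + 2 - k = k + 2 by omega] at hr
    rw [add_zero] at h
    rw [show 2 * (k + 1) = 2 * k + 2 by ring]
    refine Nat.eq_of_mul_eq_mul_left (Nat.succ_pos (k + 1)) ?_
    rw [Nat.succ_eq_add_one]
    nlinarith

/-- For `n ≥ 3`, `d(2n−5, 5) = cₙ − 4·cₙ₋₁ + 3·cₙ₋₂`. -/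
theorem dyckD_isoline_five (n : ℕ) (hn : 3 ≤ n) :
    (dyckD (2 * n - 5) 5 : ℤ) =
      catalan n - 4 * catalan (n - 1) + 3 * catalan (n - 2) := by
  obtain ⟨m, rfl⟩ := Nat.exists_eq_add_of_le' hn
  rw [show 2 * (m + 3) - 5 = 2 * m + 1 by omega, show m + 3 - 1 = m + 2 by omega,
    show m + 3 - 2 = m + 1 by omega, ← dyckD_two_mul_zero, ← dyckD_two_mul_zero,
    ← dyckD_two_mul_zero, show 2 * (m + 3) = 2 * m + 5 + 1 by ring,
    show 2 * (m + 2) = 2 * m + 3 + 1 by ring, show 2 * (m + 1) = 2 * m + 1 + 1 by ring]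
  have h50 := dyckD_succ_zero (2 * m + 5)
  have h30 := dyckD_succ_zero (2 * m + 3)
  have h10 := dyckD_succ_zero (2 * m + 1)
  have h41 := dyckD_succ_succ (2 * m + 4) 0
  have h32 := dyckD_succ_succ (2 * m + 3) 1
  have h23 := dyckD_succ_succ (2 * m + 2) 2
  have h14 := dyckD_succ_succ (2 * m + 1) 3
  have h21 := dyckD_succ_succ (2 * m + 2) 0
  have h12 := dyckD_succ_succ (2 * m + 1) 1
  simp only [add_assoc, Nat.reduceAdd] at *
  omega
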